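/- In O(SL_q(2)), let S_d be the multiplicative set generated by d and S_b the multiplicative set generated by b. The right coaction ρ_B of the quotient Hopf algebra B = O(SL_q(2))/(b) (lower Borel, with π(a) = λ, π(c) = ξ, π(d) = λ⁻¹, π(b) = 0) on O(SL_q(2)), given by ρ_B = (id ⊗ π) ∘ Δ, extends uniquely to the localizations via ρ_B(d⁻¹) = d⁻¹ ⊗ λ⁻¹ (resp. ρ_B(b⁻¹) = b⁻¹ ⊗ λ⁻¹), making S_d⁻¹O(SL_q(2)) (resp. S_b⁻¹O(SL_q(2))) a B-comodule algebra, and the algebra of localized coinvariants of S_d⁻¹O(SL_q(2)) is the polynomial algebra ℂ[u] on the single (central-in-itself, i.e. free commutative) generator u = b d⁻¹. -/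

import Mathlib

/-!
STATEMENT 14: In `O(SL_q(2))`, let `S_d`, `S_b` be the multiplicative sets generated by `d`
resp. `b`.  The right coaction `ρ_B = (id ⊗ π) ∘ Δ` of the lower Borel quotient
`B = O(SL_q(2))/(b)` extends uniquely to the Ore localizations (via
`ρ_B(d⁻¹) = d⁻¹ ⊗ π(a)` resp. `ρ_B(b⁻¹) = b⁻¹ ⊗ π(a)`), making them `B`-comodule
algebras, and the algebra of localized coinvariants of `S_d⁻¹O(SL_q(2))` is the polynomial
algebra `ℂ[u]` on the single free generator `u = b d⁻¹`.
-/

open FreeAlgebra TensorProduct OreLocalization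

inductive SLq2Rel (q : ℂ) : FreeAlgebra ℂ (Fin 4) → FreeAlgebra ℂ (Fin 4) → Prop
  | ab : SLq2Rel q (ι ℂ 0 * ι ℂ 1) (q • (ι ℂ 1 * ι ℂ 0))
  | ac : SLq2Rel q (ι ℂ 0 * ι ℂ 2) (q • (ι ℂ 2 * ι ℂ 0))
  | bc : SLq2Rel q (ι ℂ 1 * ι ℂ 2) (ι ℂ 2 * ι ℂ 1)
  | bd : SLq2Rel q (ι ℂ 1 * ι ℂ 3) (q • (ι ℂ 3 * ι ℂ 1))
  | cd : SLq2Rel q (ι ℂ 2 * ι ℂ 3) (q • (ι ℂ 3 * ι ℂ 2))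
  | adda : SLq2Rel q (ι ℂ 0 * ι ℂ 3 - ι ℂ 3 * ι ℂ 0) ((q - q⁻¹) • (ι ℂ 1 * ι ℂ 2))
  | det : SLq2Rel q (ι ℂ 0 * ι ℂ 3 - q • (ι ℂ 1 * ι ℂ 2)) 1

abbrev SLq2 (q : ℂ) : Type := RingQuot (SLq2Rel q)

noncomputable def aQ (q : ℂ) : SLq2 q := RingQuot.mkAlgHom ℂ (SLq2Rel q) (ι ℂ 0)
noncomputable def bQ (q : ℂ) : SLq2 q := RingQuot.mkAlgHom ℂ (SLq2Rel q) (ι ℂ 1)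
noncomputable def cQ (q : ℂ) : SLq2 q := RingQuot.mkAlgHom ℂ (SLq2Rel q) (ι ℂ 2)
noncomputable def dQ (q : ℂ) : SLq2 q := RingQuot.mkAlgHom ℂ (SLq2Rel q) (ι ℂ 3)

/-- Relations of the lower Borel quotient `B = O(SL_q(2))/(b)`. -/
inductive BorelRel (q : ℂ) : FreeAlgebra ℂ (Fin 4) → FreeAlgebra ℂ (Fin 4) → Prop
  | slq2 {x y} : SLq2Rel q x y → BorelRel q x y
  | bzero : BorelRel q (ι ℂ 1) 0

abbrev BorelQ (q : ℂ) : Type := RingQuot (BorelRel q)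

noncomputable def lamB (q : ℂ) : BorelQ q := RingQuot.mkAlgHom ℂ (BorelRel q) (ι ℂ 0)
noncomputable def xiB (q : ℂ) : BorelQ q := RingQuot.mkAlgHom ℂ (BorelRel q) (ι ℂ 2)
noncomputable def lamBinv (q : ℂ) : BorelQ q := RingQuot.mkAlgHom ℂ (BorelRel q) (ι ℂ 3)

/-- The numerator map `R → R[S⁻¹]` as a `ℂ`-algebra homomorphism. -/
noncomputable def numAlgHom {R : Type*} [Ring R] [Algebra ℂ R] (S : Submonoid R) [OreSet S] :
    R →ₐ[ℂ] R[S⁻¹] :=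
  { OreLocalization.numeratorRingHom with commutes' := fun _ => rfl }

section Localization

variable {R T : Type*} [Ring R] (x : R) [OreSet (Submonoid.powers x)]

theorem oreDiv_one_mul_one_oreDiv :
    (x /ₒ (1 : Submonoid.powers x) : R[(Submonoid.powers x)⁻¹]) *
      ((1 : R) /ₒ (⟨x, Submonoid.mem_powers x⟩ : Submonoid.powers x)) = 1 := by
  simpa using OreLocalization.mul_inv (⟨x, Submonoid.mem_powers x⟩ : Submonoid.powers x) 1

theorem one_oreDiv_mul_oreDiv_one :
    ((1 : R) /ₒ (⟨x, Submonoid.mem_powers x⟩ : Submonoid.powers x) : R[(Submonoid.powers x)⁻¹]) *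
      (x /ₒ (1 : Submonoid.powers x)) = 1 := by
  simp

variable [Algebra ℂ R] [Ring T] [Algebra ℂ T]

theorem exists_algHom_oreLocalization_powers (f : R →ₐ[ℂ] T) (y : T)
    (h₁ : f x * y = 1) (h₂ : y * f x = 1) :
    ∃ g : R[(Submonoid.powers x)⁻¹] →ₐ[ℂ] T,
      (∀ r : R, g (r /ₒ (1 : Submonoid.powers x)) = f r) ∧
      g ((1 : R) /ₒ (⟨x, Submonoid.mem_powers x⟩ : Submonoid.powers x)) = y := by
  let v : Tˣ := ⟨f x, y, h₁, h₂⟩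
  have hunit : ∀ s : Submonoid.powers x, IsUnit (f s) := by
    rintro ⟨_, n, rfl⟩
    simpa using v.isUnit.pow n
  let fS : Submonoid.powers x →* Tˣ :=
    IsUnit.liftRight ((f : R →* T).comp (Submonoid.powers x).subtype) hunit
  have hfS : ∀ s : Submonoid.powers x, (f : R →+* T) s = fS s := fun s =>
    (IsUnit.coe_liftRight ((f : R →* T).comp (Submonoid.powers x).subtype) hunit s).symm
  let g₀ := universalHom (f : R →+* T) fS hfS
  have hg₀ : ∀ r : R, g₀ (r /ₒ (1 : Submonoid.powers x)) = f r := fun r =>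
    universalHom_commutes (f : R →+* T) fS hfS
  let g : R[(Submonoid.powers x)⁻¹] →ₐ[ℂ] T :=
    { g₀ with commutes' := fun z => (hg₀ (algebraMap ℂ R z)).trans (f.commutes z) }
  have hg : ∀ r : R, g (r /ₒ (1 : Submonoid.powers x)) = f r := hg₀
  refine ⟨g, hg, ?_⟩
  have h : f x * g ((1 : R) /ₒ (⟨x, Submonoid.mem_powers x⟩ : Submonoid.powers x)) = 1 := by
    rw [← hg, ← map_mul, oreDiv_one_mul_one_oreDiv, map_one]
  exact (left_inv_eq_right_inv h₂ h).symm

theorem oreLocalization_powers_induction (M : Subalgebra ℂ (R[(Submonoid.powers x)⁻¹]))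
    (h : ∀ r : R, r /ₒ (1 : Submonoid.powers x) ∈ M)
    (hx : (1 : R) /ₒ (⟨x, Submonoid.mem_powers x⟩ : Submonoid.powers x) ∈ M)
    (z : R[(Submonoid.powers x)⁻¹]) : z ∈ M := by
  induction z using OreLocalization.ind with
  | _ r s =>
    obtain ⟨s, n, rfl⟩ := s
    have hpow := M.pow_mem hx n
    rw [oreDiv_pow _ _ _ (Commute.one_left _), one_pow] at hpow
    have := M.mul_mem hpow (h r)
    rwa [mul_div_one, one_mul] at this

theorem algHom_oreLocalization_powers_ext {g g' : R[(Submonoid.powers x)⁻¹] →ₐ[ℂ] T}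
    (h : ∀ r : R, g (r /ₒ (1 : Submonoid.powers x)) = g' (r /ₒ (1 : Submonoid.powers x)))
    (hx : g ((1 : R) /ₒ (⟨x, Submonoid.mem_powers x⟩ : Submonoid.powers x)) =
      g' ((1 : R) /ₒ (⟨x, Submonoid.mem_powers x⟩ : Submonoid.powers x))) : g = g' :=
  AlgHom.ext fun z => oreLocalization_powers_induction x (AlgHom.equalizer g g') h hx z

theorem existsUnique_extension_oreLocalization_powers {B : Type*} [Ring B] [Algebra ℂ B]
    (ρ : R →ₐ[ℂ] R ⊗[ℂ] B) {l m : B} (hρ : ρ x = x ⊗ₜ[ℂ] m) (hlm : l * m = 1) (hml : m * l = 1) :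
    ∃! ρ' : R[(Submonoid.powers x)⁻¹] →ₐ[ℂ] R[(Submonoid.powers x)⁻¹] ⊗[ℂ] B,
      (∀ e : R, ρ' (e /ₒ (1 : Submonoid.powers x)) =
        (Algebra.TensorProduct.map (numAlgHom (Submonoid.powers x)) (AlgHom.id ℂ B)) (ρ e)) ∧
      ρ' ((1 : R) /ₒ (⟨x, Submonoid.mem_powers x⟩ : Submonoid.powers x)) =
        ((1 : R) /ₒ (⟨x, Submonoid.mem_powers x⟩ : Submonoid.powers x)) ⊗ₜ[ℂ] l := by
  have hx : ((Algebra.TensorProduct.map (numAlgHom (Submonoid.powers x)) (AlgHom.id ℂ B)).comp ρ) x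
      = (x /ₒ (1 : Submonoid.powers x)) ⊗ₜ[ℂ] m := by
    rw [AlgHom.comp_apply, hρ]; rfl
  obtain ⟨g, hg, hgx⟩ := exists_algHom_oreLocalization_powers x
    ((Algebra.TensorProduct.map (numAlgHom (Submonoid.powers x)) (AlgHom.id ℂ B)).comp ρ)
    (((1 : R) /ₒ (⟨x, Submonoid.mem_powers x⟩ : Submonoid.powers x)) ⊗ₜ[ℂ] l)
    (by rw [hx, Algebra.TensorProduct.tmul_mul_tmul, oreDiv_one_mul_one_oreDiv, hml]; rfl)
    (by rw [hx, Algebra.TensorProduct.tmul_mul_tmul, one_oreDiv_mul_oreDiv_one, hlm]; rfl)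
  exact ⟨g, ⟨hg, hgx⟩, fun g' hg' => algHom_oreLocalization_powers_ext x
    (fun r => (hg'.1 r).trans (hg r).symm) (hg'.2.trans hgx.symm)⟩

end Localization

section Averaging

variable {L B : Type*} [Ring L] [Algebra ℂ L] [Ring B] [Algebra ℂ B] (γ : B →ₐ[ℂ] Lᵐᵒᵖ)

/-- The map `x ⊗ β ↦ x p γ(β)`, for an anti-homomorphism `γ` from `B` to `L`. -/
noncomputable def twistedMul (p : L) : L ⊗[ℂ] B →ₗ[ℂ] L :=
  TensorProduct.lift (LinearMap.mk₂ ℂ (fun x β => x * p * (γ β).unop)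
    (fun _ _ _ => by simp [add_mul]) (fun _ _ _ => by simp)
    (fun _ _ _ => by simp [mul_add]) (fun _ _ _ => by simp))

theorem twistedMul_tmul (p x : L) (β : B) : twistedMul γ p (x ⊗ₜ[ℂ] β) = x * p * (γ β).unop := rfl

theorem twistedMul_mul (t s : L ⊗[ℂ] B) :
    twistedMul γ 1 (t * s) = twistedMul γ (twistedMul γ 1 s) t := by
  induction t with
  | zero => simp
  | add t₁ t₂ h₁ h₂ => rw [add_mul, map_add, map_add, h₁, h₂]
  | tmul x β =>
    induction s with
    | zero => simp [twistedMul_tmul]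
    | add s₁ s₂ h₁ h₂ =>
      rw [mul_add, map_add, h₁, h₂, map_add]
      simp [twistedMul_tmul, mul_add, add_mul]
    | tmul y δ => simp [twistedMul_tmul, mul_assoc]

/-- The elements whose left multiplication preserves `{y | twistedMul γ 1 (ρ y) ∈ P}`. -/
def averagingStabilizer (ρ : L →ₐ[ℂ] L ⊗[ℂ] B) (P : Subalgebra ℂ L) : Subalgebra ℂ L where
  carrier := {x | ∀ y, twistedMul γ 1 (ρ y) ∈ P → twistedMul γ 1 (ρ (x * y)) ∈ P}
  mul_mem' {x x'} hx hx' y hy := by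
    rw [mul_assoc]
    exact hx _ (hx' _ hy)
  add_mem' {x x'} hx hx' y hy := by
    rw [add_mul, map_add, map_add]
    exact P.add_mem (hx y hy) (hx' y hy)
  algebraMap_mem' z y hy := by
    rw [← Algebra.smul_def, map_smul, map_smul]
    exact P.smul_mem hy z

theorem mem_averagingStabilizer {ρ : L →ₐ[ℂ] L ⊗[ℂ] B} {u x : L}
    (h : ∀ n : ℕ, twistedMul γ (u ^ n) (ρ x) ∈ (Polynomial.aeval u : Polynomial ℂ →ₐ[ℂ] L).range) :
    x ∈ averagingStabilizer γ ρ (Polynomial.aeval u : Polynomial ℂ →ₐ[ℂ] L).range := by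
  have key : ∀ (p : Polynomial ℂ) (t : L ⊗[ℂ] B), twistedMul γ (Polynomial.aeval u p) t =
      p.sum fun n z => z • twistedMul γ (u ^ n) t := by
    intro p t
    induction t with
    | zero => simp [Polynomial.sum]
    | add t₁ t₂ h₁ h₂ =>
      rw [map_add, h₁, h₂]
      simp [Polynomial.sum, Finset.sum_add_distrib]
    | tmul x β =>
      simp [twistedMul_tmul, Polynomial.aeval_eq_sum_range, Polynomial.sum_over_range,
        Finset.mul_sum, Finset.sum_mul]
  rintro y ⟨p, hp⟩
  rw [map_mul, twistedMul_mul, ← hp]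
  erw [key]
  exact Subalgebra.sum_mem _ fun n _ => Subalgebra.smul_mem _ (h n) _

theorem mem_of_coinvariant {ρ : L →ₐ[ℂ] L ⊗[ℂ] B} {P : Subalgebra ℂ L} {x : L}
    (hx : x ∈ averagingStabilizer γ ρ P) (hρ : ρ x = x ⊗ₜ[ℂ] 1) : x ∈ P := by
  have h1 : twistedMul γ 1 (ρ 1) ∈ P := by
    simp [Algebra.TensorProduct.one_def, twistedMul_tmul]
  have := hx 1 h1
  rw [mul_one, hρ, twistedMul_tmul] at this
  simpa using this

end Averaging

section QuantumSL2

variable {q : ℂ}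

theorem exists_algHom_SLq2 {T : Type*} [Ring T] [Algebra ℂ T] (a b c d : T)
    (hab : a * b = q • (b * a)) (hac : a * c = q • (c * a)) (hbc : b * c = c * b)
    (hbd : b * d = q • (d * b)) (hcd : c * d = q • (d * c))
    (had : a * d - d * a = (q - q⁻¹) • (b * c)) (hdet : a * d - q • (b * c) = 1) :
    ∃ f : SLq2 q →ₐ[ℂ] T, f (aQ q) = a ∧ f (bQ q) = b ∧ f (cQ q) = c ∧ f (dQ q) = d := by
  refine ⟨RingQuot.liftAlgHom ℂ ⟨FreeAlgebra.lift ℂ ![a, b, c, d], ?_⟩, ?_, ?_, ?_, ?_⟩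
  · intro x y h
    cases h <;> simpa
  all_goals simp [aQ, bQ, cQ, dQ, RingQuot.liftAlgHom_mkAlgHom_apply]

theorem exists_algHom_BorelQ {T : Type*} [Ring T] [Algebra ℂ T] (l x m : T)
    (hlx : l * x = q • (x * l)) (hxm : x * m = q • (m * x)) (hlm : l * m = 1) (hml : m * l = 1) :
    ∃ f : BorelQ q →ₐ[ℂ] T, f (lamB q) = l ∧ f (xiB q) = x ∧ f (lamBinv q) = m := by
  refine ⟨RingQuot.liftAlgHom ℂ ⟨FreeAlgebra.lift ℂ ![l, 0, x, m], ?_⟩, ?_, ?_, ?_⟩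
  · rintro x y (h | _)
    · cases h <;> simp [*]
    · simp
  all_goals simp [lamB, xiB, lamBinv, RingQuot.liftAlgHom_mkAlgHom_apply]

theorem bQ_mul_cQ : bQ q * cQ q = cQ q * bQ q := by
  simpa [bQ, cQ] using RingQuot.mkAlgHom_rel ℂ (SLq2Rel.bc (q := q))

theorem bQ_mul_dQ : bQ q * dQ q = q • (dQ q * bQ q) := by
  simpa [bQ, dQ] using RingQuot.mkAlgHom_rel ℂ (SLq2Rel.bd (q := q))

theorem cQ_mul_dQ : cQ q * dQ q = q • (dQ q * cQ q) := by
  simpa [cQ, dQ] using RingQuot.mkAlgHom_rel ℂ (SLq2Rel.cd (q := q))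

theorem aQ_mul_dQ : aQ q * dQ q = 1 + q • (bQ q * cQ q) := by
  have := RingQuot.mkAlgHom_rel ℂ (SLq2Rel.det (q := q))
  rw [map_sub, map_smul, map_mul, map_mul, map_one] at this
  exact sub_eq_iff_eq_add.mp this

theorem mkAlgHom_borelRel_b : RingQuot.mkAlgHom ℂ (BorelRel q) (ι ℂ 1) = 0 := by
  simpa using RingQuot.mkAlgHom_rel ℂ (BorelRel.bzero (q := q))

theorem lamB_mul_lamBinv : lamB q * lamBinv q = 1 := by
  simpa [lamB, lamBinv, mkAlgHom_borelRel_b] using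
    RingQuot.mkAlgHom_rel ℂ (BorelRel.slq2 (SLq2Rel.det (q := q)))

theorem lamBinv_mul_lamB : lamBinv q * lamB q = 1 := by
  have h := RingQuot.mkAlgHom_rel ℂ (BorelRel.slq2 (SLq2Rel.adda (q := q)))
  simp only [map_sub, map_smul, map_mul, mkAlgHom_borelRel_b, zero_mul, smul_zero] at h
  exact (sub_eq_zero.mp h).symm.trans lamB_mul_lamBinv

theorem SLq2_mem_of_generators_mem (M : Subalgebra ℂ (SLq2 q)) (ha : aQ q ∈ M) (hb : bQ q ∈ M)
    (hc : cQ q ∈ M) (hd : dQ q ∈ M) (r : SLq2 q) : r ∈ M := by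
  obtain ⟨r, rfl⟩ := RingQuot.mkAlgHom_surjective ℂ (SLq2Rel q) r
  induction r using FreeAlgebra.induction with
  | grade0 z => rw [AlgHom.commutes]; exact M.algebraMap_mem z
  | grade1 i => fin_cases i <;> assumption
  | mul x y hx hy => rw [map_mul]; exact M.mul_mem hx hy
  | add x y hx hy => rw [map_add]; exact M.add_mem hx hy

theorem mul_pow_eq_smul_pow_mul {L : Type*} [Ring L] [Algebra ℂ L] {g u : L} {z : ℂ}
    (h : g * u = z • (u * g)) (n : ℕ) : g * u ^ n = z ^ n • (u ^ n * g) := by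
  induction n with
  | zero => simp
  | succ n ih =>
    rw [pow_succ, ← mul_assoc, ih, smul_mul_assoc, mul_assoc, h, mul_smul_comm, smul_smul,
      mul_assoc, pow_succ]

theorem mul_eq_smul_mul_of_inverse {L : Type*} [Ring L] [Algebra ℂ L] {c d e : L}
    (hcd : c * d = q • (d * c)) (hde : d * e = 1) (hed : e * d = 1) : e * c = q • (c * e) := by
  calc e * c = e * (c * d) * e := by rw [mul_assoc, mul_assoc, hde, mul_one]
    _ = q • (c * e) := by rw [hcd, mul_smul_comm, ← mul_assoc, hed, one_mul, smul_mul_assoc]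

theorem exists_antiHom_BorelQ {L : Type*} [Ring L] [Algebra ℂ L] {c d e : L}
    (hcd : c * d = q • (d * c)) (hde : d * e = 1) (hed : e * d = 1) :
    ∃ γ : BorelQ q →ₐ[ℂ] Lᵐᵒᵖ,
      γ (lamB q) = .op d ∧ γ (xiB q) = .op (-(q • c)) ∧ γ (lamBinv q) = .op e :=
  exists_algHom_BorelQ _ _ _
    (MulOpposite.unop_injective (by simp [hcd]))
    (MulOpposite.unop_injective (by simp [mul_eq_smul_mul_of_inverse hcd hde hed]))
    (by rw [← MulOpposite.op_mul, hed, MulOpposite.op_one])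
    (by rw [← MulOpposite.op_mul, hde, MulOpposite.op_one])

theorem generators_mem_averagingStabilizer {L B : Type*} [Ring L] [Algebra ℂ L] [Ring B]
    [Algebra ℂ B] (hq : q ≠ 0) {a b c d e : L} {l x m : B}
    (hbc : b * c = c * b) (hbd : b * d = q • (d * b)) (hcd : c * d = q • (d * c))
    (had : a * d = 1 + q • (b * c)) (hde : d * e = 1) (hed : e * d = 1)
    (γ : B →ₐ[ℂ] Lᵐᵒᵖ) (hγl : γ l = .op d) (hγx : γ x = .op (-(q • c))) (hγm : γ m = .op e)
    (ρ : L →ₐ[ℂ] L ⊗[ℂ] B) (ha : ρ a = a ⊗ₜ l + b ⊗ₜ x) (hb : ρ b = b ⊗ₜ m)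
    (hc : ρ c = c ⊗ₜ l + d ⊗ₜ x) (hd : ρ d = d ⊗ₜ m) (he : ρ e = e ⊗ₜ l) :
    let N := averagingStabilizer γ ρ (Polynomial.aeval (e * b) : Polynomial ℂ →ₐ[ℂ] L).range
    a ∈ N ∧ b ∈ N ∧ c ∈ N ∧ d ∈ N ∧ e ∈ N := by
  intro N
  obtain ⟨u, hu⟩ : ∃ u, u = e * b := ⟨_, rfl⟩
  have hub : b = d * u := by rw [hu, ← mul_assoc, hde, one_mul]
  have hud : u * d = q • (d * u) := by
    rw [← hub, hu, mul_assoc, hbd, mul_smul_comm, ← mul_assoc, hed, one_mul]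
  have hdu : d * u = q⁻¹ • (u * d) := by rw [hud, inv_smul_smul₀ hq]
  have heu := mul_eq_smul_mul_of_inverse hud hde hed
  have hec := mul_eq_smul_mul_of_inverse hcd hde hed
  have hcu : c * u = q⁻¹ • (u * c) := by
    rw [hu, mul_assoc, hbc, ← mul_assoc, ← mul_assoc, hec, smul_mul_assoc, inv_smul_smul₀ hq]
  have hdun := mul_pow_eq_smul_pow_mul hdu
  have heun := mul_pow_eq_smul_pow_mul heu
  have hcun := mul_pow_eq_smul_pow_mul hcu
  have hqn (n : ℕ) : q ^ n * q⁻¹ ^ n = 1 := by rw [← mul_pow, mul_inv_cancel₀ hq, one_pow]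
  have hund (n : ℕ) : u ^ n * d = q ^ n • (d * u ^ n) := by
    rw [hdun, smul_smul, hqn, one_smul]
  have hmem (n : ℕ) (z : ℂ) :
      z • u ^ n ∈ (Polynomial.aeval u : Polynomial ℂ →ₐ[ℂ] L).range :=
    ⟨z • Polynomial.X ^ n, by simp⟩
  subst N
  rw [← hu]
  refine ⟨mem_averagingStabilizer γ fun n => ?_, mem_averagingStabilizer γ fun n => ?_,
    mem_averagingStabilizer γ fun n => ?_, mem_averagingStabilizer γ fun n => ?_,
    mem_averagingStabilizer γ fun n => ?_⟩
  · have : twistedMul γ (u ^ n) (ρ a) = q ^ n • u ^ n := by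
      rw [ha, map_add, twistedMul_tmul, twistedMul_tmul, hγl, hγx, MulOpposite.unop_op,
        MulOpposite.unop_op, mul_assoc, hund, mul_smul_comm, ← mul_assoc, had, add_mul, one_mul,
        smul_mul_assoc, mul_assoc b c, hcun, mul_smul_comm, smul_add, smul_smul, smul_smul,
        mul_right_comm, hqn, one_mul, mul_neg, mul_smul_comm, mul_assoc, add_neg_cancel_right]
    rw [this]
    exact hmem n _
  · have : twistedMul γ (u ^ n) (ρ b) = q⁻¹ ^ (n + 1) • u ^ (n + 1) := by
      rw [hb, twistedMul_tmul, hγm, MulOpposite.unop_op, hub, mul_assoc d, ← pow_succ', hdun,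
        smul_mul_assoc, mul_assoc, hde, mul_one]
    rw [this]
    exact hmem _ _
  · have : twistedMul γ (u ^ n) (ρ c) = 0 := by
      rw [hc, map_add, twistedMul_tmul, twistedMul_tmul, hγl, hγx, MulOpposite.unop_op,
        MulOpposite.unop_op, hcun, hdun, smul_mul_assoc, smul_mul_assoc, mul_assoc, mul_assoc,
        hcd, mul_neg, mul_neg, mul_smul_comm, mul_smul_comm, mul_smul_comm, smul_neg,
        add_neg_cancel]
    rw [this]
    exact Subalgebra.zero_mem _
  · have : twistedMul γ (u ^ n) (ρ d) = q⁻¹ ^ n • u ^ n := by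
      rw [hd, twistedMul_tmul, hγm, MulOpposite.unop_op, hdun, smul_mul_assoc, mul_assoc, hde,
        mul_one]
    rw [this]
    exact hmem _ _
  · have : twistedMul γ (u ^ n) (ρ e) = q ^ n • u ^ n := by
      rw [he, twistedMul_tmul, hγl, MulOpposite.unop_op, heun, smul_mul_assoc, mul_assoc, hed,
        mul_one]
    rw [this]
    exact hmem _ _

/-- The substitution `X ↦ z X` on polynomials. -/
noncomputable def dilation (z : ℂ) : Module.End ℂ (Polynomial ℂ) :=
  (Polynomial.aeval (z • Polynomial.X : Polynomial ℂ)).toLinearMap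

theorem dilation_X_pow (z : ℂ) (n : ℕ) :
    dilation z (Polynomial.X ^ n) = z ^ n • Polynomial.X ^ n := by
  simp [dilation, smul_pow]

theorem dilation_mul_dilation {z w : ℂ} (h : z * w = 1) : dilation z * dilation w = 1 := by
  refine Polynomial.lhom_ext' fun n => LinearMap.ext_ring ?_
  have : (z * w) ^ n = 1 := by rw [h, one_pow]
  simp [Polynomial.monomial_one_right_eq_X_pow, dilation_X_pow, smul_smul, ← mul_pow,
    mul_comm w z, h]

theorem dilation_mul_mulLeft_X (z : ℂ) :
    dilation z * LinearMap.mulLeft ℂ Polynomial.X =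
      z • (LinearMap.mulLeft ℂ Polynomial.X * dilation z) := by
  refine LinearMap.ext fun p => ?_
  simp [dilation]

theorem aeval_dilation_mul_mulLeft_X_injective (hq : q ≠ 0) : Function.Injective
    (Polynomial.aeval (dilation q * LinearMap.mulLeft ℂ Polynomial.X) :
      Polynomial ℂ →ₐ[ℂ] Module.End ℂ (Polynomial ℂ)) := by
  have hpow : ∀ n : ℕ, ∃ z : ℂ, z ≠ 0 ∧
      ((dilation q * LinearMap.mulLeft ℂ Polynomial.X : Module.End ℂ (Polynomial ℂ)) ^ n) 1 = z • Polynomial.X ^ n := by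
    intro n
    induction n with
    | zero => exact ⟨1, one_ne_zero, by simp⟩
    | succ n ih =>
      obtain ⟨z, hz, h⟩ := ih
      refine ⟨z * q ^ (n + 1), mul_ne_zero hz (pow_ne_zero _ hq), ?_⟩
      rw [pow_succ', Module.End.mul_apply, h, map_smul, Module.End.mul_apply,
        LinearMap.mulLeft_apply, ← pow_succ', dilation_X_pow, smul_smul]
  choose z hz hpow using hpow
  refine (injective_iff_map_eq_zero _).mpr fun p hp => Polynomial.ext fun n => ?_
  have h := congrArg (fun f : Module.End ℂ (Polynomial ℂ) => (f 1).coeff n) hp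
  by_contra hn
  simp [Polynomial.aeval_eq_sum_range, hpow, Polynomial.coeff_X_pow, hz] at h
  exact hn (h (Polynomial.le_natDegree_of_ne_zero hn))

end QuantumSL2

theorem borel_coaction_extends_to_localizations_and_coinvariants
    (q : ℂ) (hq : q ≠ 0)
    -- the comultiplication of O(SL_q(2)) (standard matrix comultiplication)
    (ΔA : SLq2 q →ₐ[ℂ] SLq2 q ⊗[ℂ] SLq2 q)
    (hΔa : ΔA (aQ q) = aQ q ⊗ₜ[ℂ] aQ q + bQ q ⊗ₜ[ℂ] cQ q)
    (hΔb : ΔA (bQ q) = aQ q ⊗ₜ[ℂ] bQ q + bQ q ⊗ₜ[ℂ] dQ q)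
    (hΔc : ΔA (cQ q) = cQ q ⊗ₜ[ℂ] aQ q + dQ q ⊗ₜ[ℂ] cQ q)
    (hΔd : ΔA (dQ q) = cQ q ⊗ₜ[ℂ] bQ q + dQ q ⊗ₜ[ℂ] dQ q)
    -- the Hopf algebra projection π : O(SL_q(2)) → B
    (πB : SLq2 q →ₐ[ℂ] BorelQ q)
    (hπa : πB (aQ q) = lamB q) (hπb : πB (bQ q) = 0)
    (hπc : πB (cQ q) = xiB q) (hπd : πB (dQ q) = lamBinv q)
    -- the Ore sets generated by d and b
    (hOred : OreSet (Submonoid.powers (dQ q)))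
    (hOreb : OreSet (Submonoid.powers (bQ q))) :
    letI := hOred
    letI := hOreb
    let ρB : SLq2 q →ₐ[ℂ] SLq2 q ⊗[ℂ] BorelQ q :=
      (Algebra.TensorProduct.map (AlgHom.id ℂ (SLq2 q)) πB).comp ΔA
    let Ld := OreLocalization (Submonoid.powers (dQ q)) (SLq2 q)
    let Lb := OreLocalization (Submonoid.powers (bQ q)) (SLq2 q)
    let dS : Submonoid.powers (dQ q) := ⟨dQ q, Submonoid.mem_powers _⟩
    let bS : Submonoid.powers (bQ q) := ⟨bQ q, Submonoid.mem_powers _⟩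
    let dinv : Ld := (1 : SLq2 q) /ₒ dS
    let binv : Lb := (1 : SLq2 q) /ₒ bS
    let u : Ld := bQ q /ₒ dS
    -- (1) unique B-comodule-algebra extension of ρ_B to the localization at d
    (∃! ρd : Ld →ₐ[ℂ] Ld ⊗[ℂ] BorelQ q,
        (∀ e : SLq2 q, ρd (e /ₒ (1 : Submonoid.powers (dQ q)))
            = (Algebra.TensorProduct.map (numAlgHom (Submonoid.powers (dQ q)))
                (AlgHom.id ℂ (BorelQ q))) (ρB e)) ∧
        ρd dinv = dinv ⊗ₜ[ℂ] lamB q) ∧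
    -- (2) similarly for the localization at b
    (∃! ρb : Lb →ₐ[ℂ] Lb ⊗[ℂ] BorelQ q,
        (∀ e : SLq2 q, ρb (e /ₒ (1 : Submonoid.powers (bQ q)))
            = (Algebra.TensorProduct.map (numAlgHom (Submonoid.powers (bQ q)))
                (AlgHom.id ℂ (BorelQ q))) (ρB e)) ∧
        ρb binv = binv ⊗ₜ[ℂ] lamB q) ∧
    -- (3) the localized coinvariants at d are the polynomial algebra ℂ[u], u = b d⁻¹ free
    (∀ ρd : Ld →ₐ[ℂ] Ld ⊗[ℂ] BorelQ q,
        (∀ e : SLq2 q, ρd (e /ₒ (1 : Submonoid.powers (dQ q)))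
            = (Algebra.TensorProduct.map (numAlgHom (Submonoid.powers (dQ q)))
                (AlgHom.id ℂ (BorelQ q))) (ρB e)) →
        ρd dinv = dinv ⊗ₜ[ℂ] lamB q →
        Function.Injective (Polynomial.aeval u : Polynomial ℂ →ₐ[ℂ] Ld) ∧
        ∀ x : Ld, ρd x = x ⊗ₜ[ℂ] (1 : BorelQ q) ↔
          x ∈ (Polynomial.aeval u : Polynomial ℂ →ₐ[ℂ] Ld).range) := by
  intro ρB Ld Lb dS bS dinv binv u
  have hρa : ρB (aQ q) = aQ q ⊗ₜ[ℂ] lamB q + bQ q ⊗ₜ[ℂ] xiB q := by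
    simp [ρB, hΔa, hπa, hπc]
  have hρb : ρB (bQ q) = bQ q ⊗ₜ[ℂ] lamBinv q := by
    simp [ρB, hΔb, hπb, hπd]
  have hρc : ρB (cQ q) = cQ q ⊗ₜ[ℂ] lamB q + dQ q ⊗ₜ[ℂ] xiB q := by
    simp [ρB, hΔc, hπa, hπc]
  have hρd : ρB (dQ q) = dQ q ⊗ₜ[ℂ] lamBinv q := by
    simp [ρB, hΔd, hπb, hπd]
  refine ⟨existsUnique_extension_oreLocalization_powers (dQ q) ρB hρd lamB_mul_lamBinv
      lamBinv_mul_lamB,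
    existsUnique_extension_oreLocalization_powers (bQ q) ρB hρb lamB_mul_lamBinv
      lamBinv_mul_lamB, fun ρd hρnum hρinv => ?_⟩
  let num : SLq2 q →ₐ[ℂ] Ld := numAlgHom (Submonoid.powers (dQ q))
  have hde : num (dQ q) * dinv = 1 := oreDiv_one_mul_one_oreDiv (dQ q)
  have hed : dinv * num (dQ q) = 1 := one_oreDiv_mul_oreDiv_one (dQ q)
  have hu : u = dinv * num (bQ q) := by
    change _ = ((1 : SLq2 q) /ₒ dS) * (bQ q /ₒ 1)
    rw [mul_div_one, one_mul]
  constructor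
  · obtain ⟨f, -, hfb, -, hfd⟩ := exists_algHom_SLq2 (q := q) (dilation q)
      (LinearMap.mulLeft ℂ (Polynomial.X : Polynomial ℂ)) 0 (dilation q⁻¹)
      (dilation_mul_mulLeft_X q) (by simp) (by simp)
      (by rw [dilation_mul_mulLeft_X, smul_inv_smul₀ hq]) (by simp)
      (by simp [dilation_mul_dilation, hq]) (by simp [dilation_mul_dilation, hq])
    obtain ⟨g, hg, hginv⟩ := exists_algHom_oreLocalization_powers (dQ q) f (dilation q)
      (by rw [hfd, dilation_mul_dilation (inv_mul_cancel₀ hq)])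
      (by rw [hfd, dilation_mul_dilation (mul_inv_cancel₀ hq)])
    have hgu : g u = dilation q * LinearMap.mulLeft ℂ Polynomial.X := by
      rw [hu, map_mul, ← hfb, ← hg]
      exact congrArg (· * _) hginv
    refine Function.Injective.of_comp (f := g) ?_
    rw [← AlgHom.coe_comp, ← Polynomial.aeval_algHom, hgu]
    exact aeval_dilation_mul_mulLeft_X_injective hq
  · have hda : ρd (num (aQ q)) = num (aQ q) ⊗ₜ[ℂ] lamB q + num (bQ q) ⊗ₜ[ℂ] xiB q := by
      refine (hρnum (aQ q)).trans ?_
      rw [hρa, map_add]; rfl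
    have hdb : ρd (num (bQ q)) = num (bQ q) ⊗ₜ[ℂ] lamBinv q := by
      refine (hρnum (bQ q)).trans ?_
      rw [hρb]; rfl
    have hdc : ρd (num (cQ q)) = num (cQ q) ⊗ₜ[ℂ] lamB q + num (dQ q) ⊗ₜ[ℂ] xiB q := by
      refine (hρnum (cQ q)).trans ?_
      rw [hρc, map_add]; rfl
    have hdd : ρd (num (dQ q)) = num (dQ q) ⊗ₜ[ℂ] lamBinv q := by
      refine (hρnum (dQ q)).trans ?_
      rw [hρd]; rfl
    have hcd : num (cQ q) * num (dQ q) = q • (num (dQ q) * num (cQ q)) := by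
      rw [← map_mul, cQ_mul_dQ, map_smul, map_mul]
    obtain ⟨γ, hγl, hγx, hγm⟩ := exists_antiHom_BorelQ (L := Ld) hcd hde hed
    obtain ⟨ha, hb, hc, hd, he⟩ := generators_mem_averagingStabilizer hq
      (by rw [← map_mul, bQ_mul_cQ, map_mul])
      (by rw [← map_mul, bQ_mul_dQ, map_smul, map_mul]) hcd
      (by rw [← map_mul, aQ_mul_dQ, map_add, map_one, map_smul, map_mul]) hde hed
      γ hγl hγx hγm ρd hda hdb hdc hdd hρinv
    rw [← hu] at ha hb hc hd he
    intro x
    constructor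
    · exact mem_of_coinvariant γ (oreLocalization_powers_induction (dQ q) _
        (SLq2_mem_of_generators_mem ((averagingStabilizer γ ρd _).comap num) ha hb hc hd) he x)
    · rintro ⟨p, rfl⟩
      have hρu : ρd u = Algebra.TensorProduct.includeLeft (R := ℂ) (S := ℂ) (B := BorelQ q) u := by
        rw [hu, map_mul, hρinv, hdb, Algebra.TensorProduct.tmul_mul_tmul, lamB_mul_lamBinv]
        rfl
      change ρd (Polynomial.aeval u p) =
        Algebra.TensorProduct.includeLeft (R := ℂ) (S := ℂ) (B := BorelQ q) (Polynomial.aeval u p)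
      rw [← Polynomial.aeval_algHom_apply, hρu, Polynomial.aeval_algHom_apply]
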